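/- arXiv:1506.05223 — 2 statements merged into one kernel-verified Lean document; each statement's English description precedes it below -/
import Mathlib

section
/- Let G be a finite abelian group, G₀ ⊆ G, g ∈ G₀, and let s be the smallest positive integer with s·g ∈ ⟨G₀ \ {g}⟩. If s < ord(g), then ord(s·g) > 1, and for each prime p dividing ord(s·g) there exists a minimal zero-sum sequence A over G₀ with 2 ≤ |supp(A)| ≤ r(G) + 1, s ≤ v_g(A) ≤ ord(g)/2, v_g(A) a multiple of s, and p ∤ (v_g(A)/s). -/
/-- A sequence over `G₀` (a multiset with entries in `G₀`) with sum zero. -/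
def IsZeroSumSeq {G : Type*} [AddCommGroup G] (G₀ : Set G) (S : Multiset G) : Prop :=
  (∀ g ∈ S, g ∈ G₀) ∧ S.sum = 0

/-- A minimal zero-sum sequence (atom) over `G₀`. -/
def IsAtomSeq {G : Type*} [AddCommGroup G] (G₀ : Set G) (A : Multiset G) : Prop :=
  IsZeroSumSeq G₀ A ∧ A ≠ 0 ∧ ∀ B ≤ A, B ≠ 0 → B.sum = 0 → B = A

/-- The set of lengths of factorizations of `B` into atoms over `G₀`. -/
def LengthSet {G : Type*} [AddCommGroup G] (G₀ : Set G) (B : Multiset G) : Set ℕ :=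
  {k | ∃ F : Multiset (Multiset G), F.card = k ∧ (∀ A ∈ F, IsAtomSeq G₀ A) ∧ F.sum = B}

/-- The set of successive distances of a set of naturals. -/
def DistSet (L : Set ℕ) : Set ℕ :=
  {d | ∃ a b, a ∈ L ∧ b ∈ L ∧ a < b ∧ b - a = d ∧ ∀ c ∈ L, ¬(a < c ∧ c < b)}

/-- The set of distances `Δ(G₀)`. -/
def DeltaSet {G : Type*} [AddCommGroup G] (G₀ : Set G) : Set ℕ :=
  {d | ∃ B : Multiset G, IsZeroSumSeq G₀ B ∧ d ∈ DistSet (LengthSet G₀ B)}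

/-- The cross number of a sequence. -/
noncomputable def crossNum {G : Type*} [AddCommGroup G] (S : Multiset G) : ℚ :=
  (S.map (fun g => (1 : ℚ) / addOrderOf g)).sum

/-- `G₀` is an LCN-set: every atom has cross number at least 1. -/
def IsLCNSet {G : Type*} [AddCommGroup G] (G₀ : Set G) : Prop :=
  ∀ A : Multiset G, IsAtomSeq G₀ A → 1 ≤ crossNum A

/-- The set of minimal distances `Δ*(G)`. -/
def DeltaStar (G : Type*) [AddCommGroup G] : Set ℕ :=
  {d | ∃ G₀ : Set G, DeltaSet G₀ ≠ ∅ ∧ d = sInf (DeltaSet G₀)}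

/-- `m(G)`: the maximum of `min Δ(G₀)` over non-half-factorial LCN-sets `G₀`. -/
noncomputable def mConst (G : Type*) [AddCommGroup G] : ℕ :=
  sSup {d | ∃ G₀ : Set G, IsLCNSet G₀ ∧ DeltaSet G₀ ≠ ∅ ∧ d = sInf (DeltaSet G₀)}

/-- The rank of a finite abelian group: the maximal `k` such that `(ZMod p)^k`
embeds into `G` for some prime `p`. -/
noncomputable def grank (G : Type*) [AddCommGroup G] : ℕ :=
  sSup {k | ∃ p : ℕ, p.Prime ∧ ∃ f : (Fin k → ZMod p) →+ G, Function.Injective f}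

/-- The system of sets of lengths `L(G)`. -/
def SystemSets (G : Type*) [AddCommGroup G] : Set (Set ℕ) :=
  {L | ∃ B : Multiset G, B.sum = 0 ∧ L = LengthSet Set.univ B}

/-- The Davenport constant: the maximal length of a minimal zero-sum sequence. -/
noncomputable def DavenportC (G : Type*) [AddCommGroup G] : ℕ :=
  sSup {k | ∃ A : Multiset G, IsAtomSeq (Set.univ : Set G) A ∧ A.card = k}

/-- If `X` generates `H`, then some subset of `X` of size at most the dimension of an elementary
abelian quotient `V` of `H` generates a subgroup whose image is all of `V`. -/
theorem exists_subset_closure_map_eq_top {H V : Type*} [AddCommGroup H] [AddCommGroup V] [Finite V]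
    {p : ℕ} (hp : p.Prime) (hV : ∀ y : V, p • y = 0) {X : Set H}
    (hX : AddSubgroup.closure X = ⊤) (π : H →+ V) (hπ : Function.Surjective π) :
    ∃ E ⊆ X, p ^ E.ncard ≤ Nat.card V ∧ (AddSubgroup.closure E).map π = ⊤ := by
  have : Fact p.Prime := ⟨hp⟩
  have : Module (ZMod p) V := AddCommGroup.zmodModule hV
  obtain ⟨κ, a, ha, hspan, hli⟩ := exists_linearIndependent' (ZMod p) fun x : X => π x
  have : Finite κ := hli.finite
  have := Fintype.ofFinite κ
  refine ⟨Set.range fun i => (a i : H), ?_, ?_, ?_⟩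
  · rintro _ ⟨i, rfl⟩
    exact (a i).2
  · rw [← Nat.card_coe_set_eq, Module.natCard_eq_pow_finrank (K := ZMod p) (V := V), Nat.card_zmod]
    refine Nat.pow_le_pow_right hp.pos ((Finite.card_range_le _).trans ?_)
    rw [Nat.card_eq_fintype_card]
    exact hli.fintype_card_le_finrank
  · let S : Submodule (ZMod p) V := AddSubgroup.toZModSubmodule p
      ((AddSubgroup.closure (Set.range fun i => (a i : H))).map π)
    have hS : Submodule.span (ZMod p) (Set.range fun x : X => π x) ≤ S := by
      rw [← hspan, Submodule.span_le]
      rintro _ ⟨i, rfl⟩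
      exact ⟨a i, AddSubgroup.subset_closure ⟨i, rfl⟩, rfl⟩
    have hXS : AddSubgroup.closure X ≤ S.toAddSubgroup.comap π := by
      rw [AddSubgroup.closure_le]
      exact fun x hx => hS (Submodule.subset_span ⟨⟨x, hx⟩, rfl⟩)
    refine (AddSubgroup.eq_top_iff' _).2 fun y => ?_
    obtain ⟨x, rfl⟩ := hπ y
    exact hXS (hX ▸ AddSubgroup.mem_top x)

theorem exists_injective_card_eq_pow {W : Type*} [AddCommGroup W] [Finite W] {p : ℕ}
    (hp : p.Prime) (hW : ∀ x : W, p • x = 0) :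
    ∃ k, Nat.card W = p ^ k ∧ ∃ f : (Fin k → ZMod p) →+ W, Function.Injective f := by
  have : Fact p.Prime := ⟨hp⟩
  have : Module (ZMod p) W := AddCommGroup.zmodModule hW
  let b := Module.finBasis (ZMod p) W
  refine ⟨Module.finrank (ZMod p) W, ?_, b.equivFun.symm.toLinearMap.toAddMonoidHom,
    b.equivFun.symm.injective⟩
  rw [Module.natCard_eq_pow_finrank (K := ZMod p), Nat.card_zmod]

/-- If `X` generates a finite abelian group `H`, then a subset of `X` of size at most the `p`-rank
of `H` generates a subgroup of index prime to `p`. -/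
theorem exists_small_subset_index_coprime {H : Type*} [AddCommGroup H] [Finite H] {X : Set H}
    (hX : AddSubgroup.closure X = ⊤) {p : ℕ} (hp : p.Prime) :
    ∃ E ⊆ X, ∃ k : ℕ, E.ncard ≤ k ∧ (∃ f : (Fin k → ZMod p) →+ H, Function.Injective f) ∧
      ¬ p ∣ (AddSubgroup.closure E).index := by
  have : Fact p.Prime := ⟨hp⟩
  let φ : H →+ H := nsmulAddMonoidHom p
  have hV (x : H ⧸ φ.range) : p • x = 0 := by
    induction x using QuotientAddGroup.induction_on with
    | H z => exact (QuotientAddGroup.eq_zero_iff _).2 ⟨z, rfl⟩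
  have hcard : Nat.card (H ⧸ φ.range) = Nat.card φ.ker := by
    have h₁ := φ.range.card_eq_card_quotient_mul_card_addSubgroup
    have h₂ := φ.ker.card_eq_card_quotient_mul_card_addSubgroup
    have h₃ := Nat.card_congr (QuotientAddGroup.quotientKerEquivRange φ).toEquiv
    rw [h₃, h₁, mul_comm] at h₂
    exact Nat.eq_of_mul_eq_mul_left Nat.card_pos h₂
  obtain ⟨E, hEX, hEcard, hE⟩ := exists_subset_closure_map_eq_top hp hV hX
    (QuotientAddGroup.mk' φ.range) (QuotientAddGroup.mk'_surjective _)
  obtain ⟨k, hk, f, hf⟩ := exists_injective_card_eq_pow (W := φ.ker) hp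
    fun x => Subtype.ext x.2
  rw [hcard, hk] at hEcard
  refine ⟨E, hEX, k, (Nat.pow_le_pow_iff_right hp.one_lt).1 hEcard,
    ⟨φ.ker.subtype.comp f, φ.ker.subtype_injective.comp hf⟩, ?_⟩
  intro hdvd
  obtain ⟨y, hy⟩ := exists_prime_addOrderOf_dvd_card' (G := H ⧸ AddSubgroup.closure E) p hdvd
  have hsurj : Function.Surjective fun x : H ⧸ AddSubgroup.closure E => p • x := by
    intro x
    induction x using QuotientAddGroup.induction_on with
    | H z =>
      obtain ⟨e, he, hez⟩ := hE ▸ AddSubgroup.mem_top (QuotientAddGroup.mk' φ.range z)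
      obtain ⟨w, hw⟩ := QuotientAddGroup.eq.1 hez
      refine ⟨(w : H ⧸ AddSubgroup.closure E), ?_⟩
      have hw' : p • w = -e + z := hw
      change ((p • w : H) : H ⧸ AddSubgroup.closure E) = _
      rw [hw', QuotientAddGroup.eq]
      simpa using he
  have hinj := Finite.injective_iff_surjective.2 hsurj
  have hy0 : y = 0 := hinj (by simp [← hy, addOrderOf_nsmul_eq_zero])
  rw [hy0, addOrderOf_zero] at hy
  exact hp.one_lt.ne hy

theorem le_grank {G : Type*} [AddCommGroup G] [Finite G] {p k : ℕ} (hp : p.Prime)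
    (f : (Fin k → ZMod p) →+ G) (hf : Function.Injective f) : k ≤ grank G := by
  refine le_csSup ⟨Nat.card G, ?_⟩ ⟨p, hp, f, hf⟩
  rintro k ⟨p, hp, f, hf⟩
  have h := Nat.card_le_card_of_injective f hf
  rw [Nat.card_fun, Nat.card_zmod, Nat.card_eq_fintype_card, Fintype.card_fin] at h
  exact (Nat.lt_pow_self hp.one_lt).le.trans h

theorem exists_subset_ncard_le_grank {G : Type*} [AddCommGroup G] [Finite G] (X : Set G)
    {p : ℕ} (hp : p.Prime) :
    ∃ E ⊆ X, E.ncard ≤ grank G ∧ ∃ d : ℕ, ¬ p ∣ d ∧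
      ∀ h ∈ AddSubgroup.closure X, d • h ∈ AddSubgroup.closure E := by
  obtain ⟨E, hE, k, hk, ⟨f, hf⟩, hd⟩ := exists_small_subset_index_coprime
    (AddSubgroup.closure_closure_coe_preimage (k := X)) hp
  refine ⟨(AddSubgroup.closure X).subtype '' E, ?_, ?_, _, hd, ?_⟩
  · rintro _ ⟨x, hx, rfl⟩
    exact hE hx
  · exact (Set.ncard_image_le E.toFinite).trans (hk.trans
      (le_grank hp ((AddSubgroup.closure X).subtype.comp f)
        ((AddSubgroup.closure X).subtype_injective.comp hf)))
  · intro h hh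
    rw [← AddMonoidHom.map_closure]
    exact ⟨_, AddSubgroup.nsmul_index_mem (AddSubgroup.closure E) ⟨h, hh⟩, rfl⟩

theorem nsmul_mem_iff_addOrderOf_mk_dvd {G : Type*} [AddCommGroup G] (K : AddSubgroup G) (g : G)
    (k : ℕ) : k • g ∈ K ↔ addOrderOf (g : G ⧸ K) ∣ k := by
  rw [addOrderOf_dvd_iff_nsmul_eq_zero, ← QuotientAddGroup.mk_nsmul, QuotientAddGroup.eq_zero_iff]

theorem sInf_nsmul_mem_eq_addOrderOf {G : Type*} [AddCommGroup G] [Finite G] (K : AddSubgroup G)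
    (g : G) : sInf {k : ℕ | 0 < k ∧ k • g ∈ K} = addOrderOf (g : G ⧸ K) := by
  have hmem : addOrderOf (g : G ⧸ K) ∈ {k : ℕ | 0 < k ∧ k • g ∈ K} :=
    ⟨addOrderOf_pos _, (nsmul_mem_iff_addOrderOf_mk_dvd K g _).2 dvd_rfl⟩
  refine le_antisymm (Nat.sInf_le hmem) ?_
  obtain ⟨h₀, h⟩ := Nat.sInf_mem ⟨_, hmem⟩
  exact Nat.le_of_dvd h₀ ((nsmul_mem_iff_addOrderOf_mk_dvd K g _).1 h)

/-- Every zero-sum sequence containing `g` has an atom containing `g` as a subsequence. -/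
theorem exists_atom_le_of_mem {G : Type*} [AddCommGroup G] [DecidableEq G] {G₀ : Set G}
    {B : Multiset G} (hB : IsZeroSumSeq G₀ B) {g : G} (hg : g ∈ B) :
    ∃ A ≤ B, IsAtomSeq G₀ A ∧ g ∈ A := by
  obtain ⟨A, ⟨hAB, hA0, hgA⟩, hmin⟩ := WellFounded.has_min
    (wellFounded_lt : WellFounded ((· < ·) : Multiset G → Multiset G → Prop))
    {A | A ≤ B ∧ A.sum = 0 ∧ g ∈ A} ⟨B, le_rfl, hB.2, hg⟩
  refine ⟨A, hAB, ⟨⟨fun x hx => hB.1 x (Multiset.mem_of_le hAB hx), hA0⟩, ?_, ?_⟩, hgA⟩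
  · rintro rfl
    simp at hgA
  · intro C hCA hC hC0
    by_contra hne
    have hlt : C < A := lt_of_le_of_ne hCA hne
    by_cases hgC : g ∈ C
    · exact hmin C ⟨hCA.trans hAB, hC0, hgC⟩ hlt
    · have hadd : A - C + C = A := tsub_add_cancel_of_le hCA
      refine hmin (A - C) ⟨tsub_le_self.trans hAB, ?_, ?_⟩ ?_
      · have := congrArg Multiset.sum hadd
        rwa [Multiset.sum_add, hC0, add_zero, hA0] at this
      · have := hadd ▸ hgA
        exact (Multiset.mem_add.1 this).resolve_right hgC
      · refine lt_of_le_of_ne tsub_le_self fun h => hC ?_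
        rw [h] at hadd
        simpa using hadd

/-- There is an atom over `insert g E` in which the multiplicity of `g` is the least positive `k`
with `k • g` in the subgroup generated by `E`. -/
theorem exists_atom_count_eq_addOrderOf {G : Type*} [AddCommGroup G] [Finite G] [DecidableEq G]
    {E : Set G} {g : G} (hgE : g ∉ E) :
    ∃ A : Multiset G, IsAtomSeq (insert g E) A ∧
      A.count g = addOrderOf (g : G ⧸ AddSubgroup.closure E) := by
  set d := addOrderOf (g : G ⧸ AddSubgroup.closure E) with hd
  have hdpos : 0 < d := addOrderOf_pos _
  have hdg : d • g ∈ AddSubgroup.closure E := (nsmul_mem_iff_addOrderOf_mk_dvd _ g _).2 dvd_rfl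
  have hmem : -(d • g) ∈ AddSubmonoid.closure E := by
    rw [← AddSubgroup.closure_toAddSubmonoid_of_finite]
    exact (AddSubgroup.closure E).neg_mem hdg
  obtain ⟨M, hM, hMsum⟩ := AddSubmonoid.exists_multiset_of_mem_closure hmem
  have hcount : (Multiset.replicate d g + M).count g = d := by
    rw [Multiset.count_add, Multiset.count_replicate_self,
      Multiset.count_eq_zero_of_notMem fun h => hgE (hM g h), add_zero]
  have hB : IsZeroSumSeq (insert g E) (Multiset.replicate d g + M) := by
    refine ⟨fun x hx => ?_, by simp [hMsum]⟩
    rcases Multiset.mem_add.1 hx with hx | hx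
    · exact Or.inl (Multiset.eq_of_mem_replicate hx)
    · exact Or.inr (hM x hx)
  obtain ⟨A, hAB, hA, hgA⟩ := exists_atom_le_of_mem hB (g := g)
    (Multiset.count_pos.1 (hcount.symm ▸ hdpos))
  refine ⟨A, hA, le_antisymm (hcount ▸ Multiset.count_le_of_le g hAB) ?_⟩
  refine Nat.le_of_dvd (Multiset.count_pos.2 hgA)
    ((nsmul_mem_iff_addOrderOf_mk_dvd (AddSubgroup.closure E) g _).1 ?_)
  have hsum := congrArg Multiset.sum (Multiset.filter_add_not (fun x => x = g) A)
  rw [Multiset.sum_add, hA.1.2, Multiset.filter_eq', Multiset.sum_replicate] at hsum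
  rw [eq_neg_of_add_eq_zero_left hsum]
  refine neg_mem (multiset_sum_mem _ fun x hx => ?_)
  obtain ⟨hxA, hxg⟩ := Multiset.mem_filter.1 hx
  exact AddSubgroup.subset_closure ((hA.1.1 x hxA).resolve_left hxg)

theorem stmt_2 {G : Type*} [AddCommGroup G] [Fintype G] [DecidableEq G] (G₀ : Set G)
    (g : G) (hg : g ∈ G₀) (s : ℕ)
    (hs : s = sInf {k : ℕ | 0 < k ∧ k • g ∈ AddSubgroup.closure (G₀ \ {g})})
    (hlt : s < addOrderOf g) :
    1 < addOrderOf (s • g) ∧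
    ∀ p : ℕ, p.Prime → p ∣ addOrderOf (s • g) →
      ∃ A : Multiset G, IsAtomSeq G₀ A ∧
        2 ≤ {x : G | x ∈ A}.ncard ∧ {x : G | x ∈ A}.ncard ≤ grank G + 1 ∧
        s ≤ A.count g ∧ 2 * A.count g ≤ addOrderOf g ∧
        s ∣ A.count g ∧ ¬ p ∣ (A.count g / s) := by
  rw [sInf_nsmul_mem_eq_addOrderOf] at hs
  have hspos : 0 < s := hs ▸ addOrderOf_pos _
  have hsg : s • g ∈ AddSubgroup.closure (G₀ \ {g}) :=
    (nsmul_mem_iff_addOrderOf_mk_dvd _ g s).2 (dvd_of_eq hs.symm)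
  have hsdvd : s ∣ addOrderOf g := by
    rw [hs, ← nsmul_mem_iff_addOrderOf_mk_dvd, addOrderOf_nsmul_eq_zero]
    exact zero_mem _
  have hord : addOrderOf g = s * addOrderOf (s • g) := by
    rw [addOrderOf_nsmul_of_dvd hspos.ne' hsdvd, Nat.mul_div_cancel' hsdvd]
  refine ⟨by by_contra! h; nlinarith, fun p hp hpdvd => ?_⟩
  obtain ⟨E, hE, hEcard, m, hpm, hm⟩ := exists_subset_ncard_le_grank (G₀ \ {g}) hp
  have hgE : g ∉ E := fun h => (hE h).2 rfl
  obtain ⟨A, hA, hcount⟩ := exists_atom_count_eq_addOrderOf hgE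
  set d := addOrderOf (g : G ⧸ AddSubgroup.closure E) with hd
  have hdpos : 0 < d := addOrderOf_pos _
  have hdg : d • g ∈ AddSubgroup.closure E := (nsmul_mem_iff_addOrderOf_mk_dvd _ g _).2 dvd_rfl
  obtain ⟨c, hc⟩ : s ∣ d := by
    rw [hs, ← nsmul_mem_iff_addOrderOf_mk_dvd]
    exact AddSubgroup.closure_mono hE hdg
  have hpc : ¬ p ∣ c := by
    have h : d ∣ s * m := by
      rw [hd, ← nsmul_mem_iff_addOrderOf_mk_dvd, mul_nsmul]
      exact hm _ hsg
    rw [hc] at h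
    exact fun hpc => hpm (hpc.trans (Nat.dvd_of_mul_dvd_mul_left hspos h))
  obtain ⟨e, he⟩ : d ∣ addOrderOf g := by
    rw [hd, ← nsmul_mem_iff_addOrderOf_mk_dvd, addOrderOf_nsmul_eq_zero]
    exact zero_mem _
  have hgpos : 0 < addOrderOf g := addOrderOf_pos g
  have he2 : 2 ≤ e := by
    by_contra! h
    interval_cases e
    · omega
    · rw [mul_one, hord, hc] at he
      exact hpc (Nat.eq_of_mul_eq_mul_left hspos he ▸ hpdvd)
  have hdlt : d < addOrderOf g := by nlinarith
  have hgA : g ∈ A := Multiset.count_pos.1 (hcount.symm ▸ hdpos)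
  have hsub : insert g E ⊆ G₀ := Set.insert_subset hg (hE.trans Set.sdiff_subset)
  refine ⟨A, ⟨⟨fun x hx => hsub (hA.1.1 x hx), hA.1.2⟩, hA.2⟩, ?_, ?_, ?_, ?_, ?_, ?_⟩
  · by_contra! h
    have h1 : {x : G | x ∈ A}.ncard ≤ 1 := by omega
    rw [Set.ncard_le_one_iff] at h1
    have hrep : A = Multiset.replicate A.card g :=
      Multiset.eq_replicate_card.2 fun x hx => h1 hx hgA
    have hcard : A.card = d := by
      rw [← hcount]
      conv_rhs => rw [hrep]
      rw [Multiset.count_replicate_self]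
    have hsum := hA.1.2
    rw [hrep, Multiset.sum_replicate, hcard, ← addOrderOf_dvd_iff_nsmul_eq_zero] at hsum
    exact absurd (Nat.le_of_dvd hdpos hsum) (not_le.2 hdlt)
  · calc {x : G | x ∈ A}.ncard ≤ (insert g E).ncard := Set.ncard_le_ncard hA.1.1
      _ ≤ E.ncard + 1 := Set.ncard_insert_le g E
      _ ≤ grank G + 1 := by omega
  · rw [hcount]
    exact Nat.le_of_dvd hdpos ⟨c, hc⟩
  · rw [hcount, he, mul_comm]
    exact Nat.mul_le_mul_left d he2
  · exact ⟨c, hcount.trans hc⟩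
  · rwa [hcount, hc, Nat.mul_div_cancel_left c hspos]
end

section
/- Let G be a finite abelian group with exp(G) = n and rank r, and let G₀ ⊆ G be a minimal non-half-factorial LCN-set with |G₀| ≥ r + 2 such that for every h ∈ G₀, h ∈ ⟨G₀ \ {h}⟩ but h ∉ ⟨G₀ \ {h, h'}⟩ for any h' ≠ h in G₀. If moreover every atom A over G₀ with supp(A) = G₀ has cross number k(A) > 1, then min Δ(G₀) ≤ 5n/6 − 4. -/
section Rank
variable {G : Type*} [AddCommGroup G] [Finite G]

theorem le_grank_of_injective {p k : ℕ} (hp : p.Prime) (f : (Fin k → ZMod p) →+ G)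
    (hf : Function.Injective f) : k ≤ grank G := by
  have bdd : BddAbove {k | ∃ p : ℕ, p.Prime ∧ ∃ f : (Fin k → ZMod p) →+ G,
      Function.Injective f} := by
    refine ⟨Nat.card G, ?_⟩
    rintro k ⟨p, hp, f, hf⟩
    have := Fact.mk hp
    have h := Nat.card_le_card_of_injective f hf
    rw [Nat.card_eq_fintype_card, Fintype.card_fun, ZMod.card, Fintype.card_fin] at h
    exact (Nat.lt_pow_self hp.one_lt).le.trans h
  exact le_csSup bdd ⟨p, hp, f, hf⟩

theorem exists_injective_of_pow_le_card {p k : ℕ} [Fact p.Prime] {K : Type*} [AddCommGroup K]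
    [Finite K] [Module (ZMod p) K] (hcard : p ^ k ≤ Nat.card K) :
    ∃ f : (Fin k → ZMod p) →+ K, Function.Injective f := by
  rw [Module.natCard_eq_pow_finrank (K := ZMod p) (V := K), Nat.card_zmod] at hcard
  obtain ⟨v, hv⟩ := exists_linearIndependent_of_le_finrank
    ((Nat.pow_le_pow_iff_right (Fact.out : p.Prime).one_lt).1 hcard)
  exact ⟨(Fintype.linearCombination (ZMod p) v).toAddMonoidHom,
    linearIndependent_iff_injective_fintypeLinearCombination.1 hv⟩

/-- Elements whose relations all have coefficients divisible by `p` are at most `grank G` many. -/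
theorem card_le_grank {p : ℕ} (hp : p.Prime) {ι : Type*} [Fintype ι] (g : ι → G)
    (hg : ∀ c : ι → ℤ, ∑ i, c i • g i = 0 → ∀ i, (p : ℤ) ∣ c i) :
    Fintype.card ι ≤ grank G := by
  classical
  have := Fact.mk hp
  let f : (ι → ℤ) →+ G :=
    { toFun := fun c => ∑ i, c i • g i
      map_zero' := by simp
      map_add' := fun a b => by simp [add_smul, Finset.sum_add_distrib] }
  let M := f.range
  let μ : M →+ M := nsmulAddMonoidHom p
  have hcard : Nat.card μ.ker = Nat.card (M ⧸ μ.range) := by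
    have h1 := AddSubgroup.card_mul_index μ.ker
    rw [AddSubgroup.index_ker] at h1
    have h2 := AddSubgroup.card_mul_index μ.range
    have h3 : 0 < Nat.card μ.range := Nat.card_pos
    have h4 : Nat.card (M ⧸ μ.range) = μ.range.index := rfl
    rw [h4]
    nlinarith
  have hinj : Function.Injective (fun c : ι → ZMod p =>
      (QuotientAddGroup.mk (f.rangeRestrict (fun i => ((c i).val : ℤ))) : M ⧸ μ.range)) := by
    intro c c' h
    rw [QuotientAddGroup.eq] at h
    obtain ⟨⟨_, b, rfl⟩, hb⟩ := h
    have hb' : p • f b = - f (fun i => ((c i).val : ℤ)) + f (fun i => ((c' i).val : ℤ)) :=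
      congrArg Subtype.val hb
    have h0 : f ((fun i => ((c' i).val : ℤ)) - (fun i => ((c i).val : ℤ)) - p • b) = 0 := by
      rw [map_sub, map_sub, map_nsmul, hb']; abel
    ext i
    have := hg _ h0 i
    simp only [Pi.sub_apply, Pi.smul_apply] at this
    have h5 : (p : ℤ) ∣ (c' i).val - (c i).val := by
      have := this.add (Dvd.intro (b i) rfl : (p : ℤ) ∣ p * b i)
      simpa using this
    have h6 := (ZMod.intCast_zmod_eq_zero_iff_dvd _ p).2 h5
    push_cast at h6
    simp only [ZMod.natCast_zmod_val] at h6
    exact (sub_eq_zero.1 h6).symm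
  have hle : p ^ Fintype.card ι ≤ Nat.card μ.ker := by
    rw [hcard]
    refine le_trans (le_of_eq ?_) (Nat.card_le_card_of_injective _ hinj)
    rw [Nat.card_eq_fintype_card, Fintype.card_fun, ZMod.card]
  let : Module (ZMod p) μ.ker :=
    AddCommGroup.zmodModule fun x : μ.ker => Subtype.ext x.2
  obtain ⟨e, he⟩ := exists_injective_of_pow_le_card hle
  exact le_grank_of_injective hp (M.subtype.comp (μ.ker.subtype.comp e))
    (Subtype.val_injective.comp (Subtype.val_injective.comp he))

end Rank

/-- A finite group is exhausted by short sums of generators. -/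
theorem exists_short_list_sum {Z β : Type*} [AddCommGroup Z] [Finite Z] (f : β → Z)
    (hf : AddSubgroup.closure (Set.range f) = ⊤) (x : Z) :
    ∃ l : List β, l.length < Nat.card Z ∧ (l.map f).sum = x := by
  classical
  have hex : ∃ k, ∃ l : List β, l.length = k ∧ (l.map f).sum = x := by
    have hx : x ∈ AddSubmonoid.closure (Set.range f) := by
      rw [← AddSubgroup.closure_toAddSubmonoid_of_finite, hf]; trivial
    induction hx using AddSubmonoid.closure_induction with
    | mem x h => obtain ⟨b, rfl⟩ := h; exact ⟨_, [b], rfl, by simp⟩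
    | zero => exact ⟨_, [], rfl, by simp⟩
    | add x y _ _ hx hy =>
      obtain ⟨_, l, -, rfl⟩ := hx
      obtain ⟨_, l', -, rfl⟩ := hy
      exact ⟨_, l ++ l', rfl, by simp⟩
  obtain ⟨l, hl, hlx⟩ := Nat.find_spec hex
  refine ⟨l, ?_, hlx⟩
  by_contra! hlen
  have := Fintype.ofFinite Z
  obtain ⟨i, j, hij, hs⟩ := Fintype.exists_ne_map_eq_of_card_lt
    (fun i : Fin (l.length + 1) => ((l.take i).map f).sum) (by
      rw [Fintype.card_fin, ← Nat.card_eq_fintype_card]; omega)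
  wlog h : i < j generalizing i j
  · exact this j i hij.symm hs.symm (lt_of_le_of_ne (not_lt.1 h) hij.symm)
  refine Nat.find_min hex (m := (l.take i ++ l.drop j).length) ?_ ⟨_, rfl, ?_⟩
  · have := j.2
    have : (i : ℕ) < j := h
    rw [← hl, List.length_append, List.length_take, List.length_drop]
    omega
  · rw [List.map_append, List.sum_append]
    rw [hs, ← List.sum_append, ← List.map_append, List.take_append_drop, hlx]

section CrossNumber
variable {G : Type*} [AddCommGroup G]

theorem crossNum_add (S T : Multiset G) : crossNum (S + T) = crossNum S + crossNum T := by
  simp [crossNum]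

theorem crossNum_sum (F : Multiset (Multiset G)) : crossNum F.sum = (F.map crossNum).sum := by
  induction F using Multiset.induction with
  | empty => simp [crossNum]
  | cons A F ih => rw [Multiset.sum_cons, crossNum_add, ih, Multiset.map_cons, Multiset.sum_cons]

theorem crossNum_sum_eq_card {F : Multiset (Multiset G)} (hF : ∀ A ∈ F, crossNum A = 1) :
    crossNum F.sum = F.card := by
  rw [crossNum_sum, Multiset.map_congr rfl hF]
  simp

theorem crossNum_replicate_addOrderOf [Finite G] (g : G) :
    crossNum (Multiset.replicate (addOrderOf g) g) = 1 := by
  have : (addOrderOf g : ℚ) ≠ 0 := by exact_mod_cast (addOrderOf_pos g).ne'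
  simp [crossNum, this]

end CrossNumber

section Factorization
variable {G : Type*} [AddCommGroup G]

theorem IsAtomSeq.mono {G₀ G₁ : Set G} {A : Multiset G} (hA : IsAtomSeq G₁ A)
    (h : ∀ g ∈ A, g ∈ G₀) : IsAtomSeq G₀ A :=
  ⟨⟨h, hA.1.2⟩, hA.2⟩

theorem isAtomSeq_replicate_addOrderOf [Finite G] {G₀ : Set G} {g : G} (hg : g ∈ G₀) :
    IsAtomSeq G₀ (Multiset.replicate (addOrderOf g) g) := by
  refine ⟨⟨fun x hx => Multiset.eq_of_mem_replicate hx ▸ hg, by simp⟩, ?_, ?_⟩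
  · rw [← Multiset.card_pos, Multiset.card_replicate]
    exact addOrderOf_pos g
  · intro B hB hB0 hBs
    obtain ⟨k, hk, rfl⟩ := Multiset.le_replicate_iff.1 hB
    rw [Multiset.sum_replicate] at hBs
    have hk0 : k ≠ 0 := by rintro rfl; exact hB0 rfl
    rw [hk.antisymm (Nat.le_of_dvd (Nat.pos_of_ne_zero hk0)
      (addOrderOf_dvd_iff_nsmul_eq_zero.2 hBs))]

theorem IsZeroSumSeq.exists_factorization {G₀ : Set G} {S : Multiset G}
    (hS : IsZeroSumSeq G₀ S) :
    ∃ F : Multiset (Multiset G), (∀ A ∈ F, IsAtomSeq G₀ A) ∧ F.sum = S := by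
  induction hk : S.card using Nat.strong_induction_on generalizing S with
  | _ k ih =>
  subst hk
  by_cases h0 : S = 0
  · exact ⟨0, by simp, by simp [h0]⟩
  by_cases hat : IsAtomSeq G₀ S
  · exact ⟨{S}, by simpa using hat, by simp⟩
  have hB : ∃ B ≤ S, B ≠ 0 ∧ B.sum = 0 ∧ B ≠ S := by
    by_contra! hB
    exact hat ⟨hS, h0, hB⟩
  obtain ⟨B, hle, hB0, hBs, hBS⟩ := hB
  obtain ⟨C, rfl⟩ := Multiset.le_iff_exists_add.1 hle
  have hC0 : C ≠ 0 := by rintro rfl; simp at hBS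
  have hCs : C.sum = 0 := by simpa [hBs] using hS.2
  have hBc := Multiset.card_pos.2 hB0
  have hCc := Multiset.card_pos.2 hC0
  obtain ⟨F₁, h₁, h₁'⟩ := ih B.card (by rw [Multiset.card_add]; omega)
    ⟨fun g hg => hS.1 g (Multiset.mem_add.2 (Or.inl hg)), hBs⟩ rfl
  obtain ⟨F₂, h₂, h₂'⟩ := ih C.card (by rw [Multiset.card_add]; omega)
    ⟨fun g hg => hS.1 g (Multiset.mem_add.2 (Or.inr hg)), hCs⟩ rfl
  refine ⟨F₁ + F₂, ?_, by rw [Multiset.sum_add, h₁', h₂']⟩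
  intro A hA
  exact (Multiset.mem_add.1 hA).elim (h₁ A) (h₂ A)

theorem isZeroSumSeq_sum {G₀ : Set G} {F : Multiset (Multiset G)}
    (hF : ∀ A ∈ F, IsAtomSeq G₀ A) : IsZeroSumSeq G₀ F.sum := by
  induction F using Multiset.induction with
  | empty => simp [IsZeroSumSeq]
  | cons A F ih =>
    have h₁ := (hF A (Multiset.mem_cons_self A F)).1
    have h₂ := ih fun B hB => hF B (Multiset.mem_cons_of_mem hB)
    refine ⟨fun g hg => ?_, by rw [Multiset.sum_cons, Multiset.sum_add, h₁.2, h₂.2, add_zero]⟩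
    rw [Multiset.sum_cons, Multiset.mem_add] at hg
    exact hg.elim (h₁.1 g) (h₂.1 g)

theorem exists_mem_deltaSet_le {G₀ : Set G} {B : Multiset G} (hB : IsZeroSumSeq G₀ B) {k l : ℕ}
    (hk : k ∈ LengthSet G₀ B) (hl : l ∈ LengthSet G₀ B) (hkl : k < l) :
    ∃ d ∈ DeltaSet G₀, d ≤ l - k := by
  induction l using Nat.strong_induction_on with
  | _ l ih =>
  by_cases h : ∃ c ∈ LengthSet G₀ B, k < c ∧ c < l
  · obtain ⟨c, hc, hkc, hcl⟩ := h
    obtain ⟨d, hd, hdle⟩ := ih c hcl hc hkc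
    exact ⟨d, hd, by omega⟩
  · push Not at h
    exact ⟨l - k, ⟨B, hB, k, l, hk, hl, hkl, rfl, fun c hc hc' =>
      absurd hc'.2 (not_lt.2 (h c hc hc'.1))⟩, le_rfl⟩

/-- Two factorizations with the same product bound the minimal distance. -/
theorem sInf_deltaSet_le {G₀ : Set G} {F F' : Multiset (Multiset G)}
    (hF : ∀ A ∈ F, IsAtomSeq G₀ A) (hF' : ∀ A ∈ F', IsAtomSeq G₀ A) (hsum : F.sum = F'.sum)
    (hlt : F.card < F'.card) : sInf (DeltaSet G₀) ≤ F'.card - F.card := by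
  obtain ⟨d, hd, hle⟩ := exists_mem_deltaSet_le (isZeroSumSeq_sum hF')
    ⟨F, rfl, hF, hsum⟩ ⟨F', rfl, hF', rfl⟩ hlt
  exact (Nat.sInf_le hd).trans hle

theorem card_eq_card_of_deltaSet_eq_empty {G₀ : Set G} (h0 : DeltaSet G₀ = ∅)
    {F F' : Multiset (Multiset G)} (hF : ∀ A ∈ F, IsAtomSeq G₀ A)
    (hF' : ∀ A ∈ F', IsAtomSeq G₀ A) (hsum : F.sum = F'.sum) : F.card = F'.card := by
  by_contra hne
  rcases lt_or_gt_of_ne hne with h | h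
  · obtain ⟨d, hd, -⟩ := exists_mem_deltaSet_le (isZeroSumSeq_sum hF')
      ⟨F, rfl, hF, hsum⟩ ⟨F', rfl, hF', rfl⟩ h
    simp [h0] at hd
  · obtain ⟨d, hd, -⟩ := exists_mem_deltaSet_le (isZeroSumSeq_sum hF')
      ⟨F', rfl, hF', rfl⟩ ⟨F, rfl, hF, hsum⟩ h
    simp [h0] at hd

theorem crossNum_eq_one [Finite G] {G₀ : Set G} (h0 : DeltaSet G₀ = ∅) {A : Multiset G}
    (hA : IsAtomSeq G₀ A) : crossNum A = 1 := by
  set N := AddMonoid.exponent G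
  have hN : (N : ℚ) ≠ 0 := by exact_mod_cast AddMonoid.exponent_ne_zero_of_finite
  let F : Multiset (Multiset G) := A.bind fun g =>
    Multiset.replicate (N / addOrderOf g) (Multiset.replicate (addOrderOf g) g)
  have hF : ∀ B ∈ F, IsAtomSeq G₀ B := by
    intro B hB
    obtain ⟨g, hg, hB⟩ := Multiset.mem_bind.1 hB
    rw [Multiset.eq_of_mem_replicate hB]
    exact isAtomSeq_replicate_addOrderOf (hA.1.1 g hg)
  have hsum : F.sum = (Multiset.replicate N A).sum := by
    have hg : ∀ g : G, (Multiset.replicate (N / addOrderOf g)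
        (Multiset.replicate (addOrderOf g) g)).sum = N • {g} := by
      intro g
      rw [Multiset.sum_replicate, ← Multiset.nsmul_singleton g, ← mul_nsmul,
        Nat.mul_div_cancel' (AddMonoid.addOrder_dvd_exponent g)]
    rw [Multiset.sum_replicate, Multiset.sum_bind]
    simp only [hg]
    rw [Multiset.sum_map_nsmul, Multiset.sum_map_singleton]
  have hcard := card_eq_card_of_deltaSet_eq_empty h0 hF
    (fun B hB => Multiset.eq_of_mem_replicate hB ▸ hA) hsum
  have hcross := crossNum_sum_eq_card (F := F) (by
    intro B hB
    obtain ⟨g, hg, hB⟩ := Multiset.mem_bind.1 hB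
    rw [Multiset.eq_of_mem_replicate hB, crossNum_replicate_addOrderOf])
  rw [hsum, crossNum_sum, hcard, Multiset.card_replicate, Multiset.map_replicate,
    Multiset.sum_replicate, nsmul_eq_mul] at hcross
  exact mul_left_cancel₀ hN (by rw [hcross, mul_one])

end Factorization

section RelOrder
variable {G : Type*} [AddCommGroup G]

/-- The least positive `m` such that `m • h` lies in the subgroup generated by `H \ {h}`
(and `0` if there is none). -/
noncomputable def relOrder (H : Set G) (h : G) : ℕ :=
  addOrderOf (QuotientAddGroup.mk h : G ⧸ AddSubgroup.closure (H \ {h}))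

theorem relOrder_dvd_iff {H : Set G} {h : G} {k : ℕ} :
    relOrder H h ∣ k ↔ k • h ∈ AddSubgroup.closure (H \ {h}) := by
  rw [relOrder, addOrderOf_dvd_iff_nsmul_eq_zero, ← QuotientAddGroup.mk_nsmul,
    QuotientAddGroup.eq_zero_iff]

theorem relOrder_dvd_iff_zsmul {H : Set G} {h : G} {k : ℤ} :
    (relOrder H h : ℤ) ∣ k ↔ k • h ∈ AddSubgroup.closure (H \ {h}) := by
  rw [relOrder, addOrderOf_dvd_iff_zsmul_eq_zero, ← QuotientAddGroup.mk_zsmul,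
    QuotientAddGroup.eq_zero_iff]

theorem relOrder_eq_one_iff {H : Set G} {h : G} :
    relOrder H h = 1 ↔ h ∈ AddSubgroup.closure (H \ {h}) := by
  rw [← Nat.dvd_one, relOrder_dvd_iff, one_nsmul]

theorem relOrder_dvd_addOrderOf (H : Set G) (h : G) : relOrder H h ∣ addOrderOf h := by
  rw [relOrder_dvd_iff, addOrderOf_nsmul_eq_zero]
  exact zero_mem _

theorem relOrder_pos [Finite G] (H : Set G) (h : G) : 0 < relOrder H h :=
  Nat.pos_of_dvd_of_pos (relOrder_dvd_addOrderOf H h) (addOrderOf_pos h)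

theorem relOrder_dvd_count [DecidableEq G] {H : Set G} {S : Multiset G}
    (hS : IsZeroSumSeq H S) (h : G) : relOrder H h ∣ S.count h := by
  rw [relOrder_dvd_iff]
  have hsum : S.count h • h + (S.filter (fun x => ¬ x = h)).sum = 0 := by
    rw [← Multiset.sum_replicate, ← Multiset.filter_eq', ← Multiset.sum_add,
      Multiset.filter_add_not, hS.2]
  rw [eq_neg_of_add_eq_zero_left hsum]
  refine neg_mem (AddSubgroup.multiset_sum_mem _ _ fun x hx => ?_)
  rw [Multiset.mem_filter] at hx
  exact AddSubgroup.subset_closure ⟨hS.1 x hx.1, hx.2⟩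

theorem count_ne_one_of_isZeroSumSeq_diff [DecidableEq G] {G₀ : Set G} {h h' : G}
    (hh : h ∉ AddSubgroup.closure (G₀ \ {h, h'})) {S : Multiset G}
    (hS : IsZeroSumSeq (G₀ \ {h'}) S) : S.count h ≠ 1 := by
  intro h1
  have := relOrder_dvd_count hS h
  rw [h1, Nat.dvd_one, relOrder_eq_one_iff, Set.sdiff_sdiff, Set.union_comm] at this
  exact hh this

theorem exists_isAtomSeq_count_eq_relOrder [Finite G] [DecidableEq G] {H : Set G} {h : G}
    (hh : h ∈ H) : ∃ A, IsAtomSeq H A ∧ A.count h = relOrder H h := by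
  have hpos := relOrder_pos H h
  obtain ⟨T, hT, hTs⟩ : ∃ T : Multiset G, (∀ x ∈ T, x ∈ H \ {h}) ∧
      T.sum = -(relOrder H h • h) := by
    have hmem : -(relOrder H h • h) ∈ AddSubmonoid.closure (H \ {h}) := by
      rw [← AddSubgroup.closure_toAddSubmonoid_of_finite, AddSubgroup.mem_toAddSubmonoid]
      exact neg_mem (relOrder_dvd_iff.1 dvd_rfl)
    exact AddSubmonoid.exists_multiset_of_mem_closure hmem
  have hS : IsZeroSumSeq H (Multiset.replicate (relOrder H h) h + T) := by
    refine ⟨fun x hx => ?_, by rw [Multiset.sum_add, Multiset.sum_replicate, hTs, add_neg_cancel]⟩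
    rcases Multiset.mem_add.1 hx with hx | hx
    · exact Multiset.eq_of_mem_replicate hx ▸ hh
    · exact (hT x hx).1
  have hcount : (Multiset.replicate (relOrder H h) h + T).count h = relOrder H h := by
    rw [Multiset.count_add, Multiset.count_replicate_self,
      Multiset.count_eq_zero_of_notMem fun hx => (hT h hx).2 rfl, add_zero]
  obtain ⟨F, hF, hFs⟩ := hS.exists_factorization
  have hmem : h ∈ F.sum := by
    rw [hFs, ← Multiset.count_pos, hcount]; exact hpos
  obtain ⟨A, hA, hhA⟩ := Multiset.mem_join.1 hmem
  refine ⟨A, hF A hA, le_antisymm ?_ ?_⟩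
  · rw [← hcount, ← hFs]
    exact Multiset.count_le_of_le h (Multiset.le_sum_of_mem hA)
  · exact Nat.le_of_dvd (Multiset.count_pos.2 hhA) (relOrder_dvd_count (hF A hA).1 h)

theorem relOrder_dvd_relOrder {G₀ : Set G} {h h' : G}
    (hh : h' ∈ AddSubgroup.closure (G₀ \ {h'})) :
    relOrder (G₀ \ {h}) h' ∣ relOrder (G₀ \ {h'}) h := by
  have hset : (G₀ \ {h}) \ {h'} = (G₀ \ {h'}) \ {h} := by
    ext; simp only [Set.mem_sdiff, Set.mem_singleton_iff]; tauto
  have hle : AddSubgroup.closure (G₀ \ {h'}) ≤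
      AddSubgroup.zmultiples h ⊔ AddSubgroup.closure ((G₀ \ {h'}) \ {h}) := by
    rw [AddSubgroup.closure_le]
    intro x hx
    by_cases hxh : x = h
    · exact AddSubgroup.mem_sup_left (hxh ▸ AddSubgroup.mem_zmultiples x)
    · exact AddSubgroup.mem_sup_right (AddSubgroup.subset_closure ⟨hx, hxh⟩)
  obtain ⟨_, ⟨c, rfl⟩, z, hz, hcz⟩ := AddSubgroup.mem_sup.1 (hle hh)
  have hm := relOrder_dvd_iff.1 (dvd_refl (relOrder (G₀ \ {h'}) h))
  generalize relOrder (G₀ \ {h'}) h = m at hm ⊢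
  have hmh : m • h' = c • m • h + m • z := by
    rw [← hcz, nsmul_add, smul_comm c m h]
  rw [relOrder_dvd_iff, hset, hmh]
  exact add_mem (zsmul_mem hm c) (nsmul_mem hz m)

theorem relOrder_comm {G₀ : Set G} {h h' : G} (hh : h ∈ AddSubgroup.closure (G₀ \ {h}))
    (hh' : h' ∈ AddSubgroup.closure (G₀ \ {h'})) :
    relOrder (G₀ \ {h'}) h = relOrder (G₀ \ {h}) h' :=
  Nat.dvd_antisymm (relOrder_dvd_relOrder hh) (relOrder_dvd_relOrder hh')

theorem exists_not_dvd_relOrder [Finite G] {H : Set G} (hH : grank G < H.ncard) {p : ℕ}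
    (hp : p.Prime) : ∃ h ∈ H, ¬ p ∣ relOrder H h := by
  classical
  by_contra! hdvd
  have := Fintype.ofFinite H
  refine absurd (card_le_grank hp (fun x : H => (x : G)) ?_) (not_le.2 ?_)
  · intro c hc i
    refine (Int.natCast_dvd_natCast.2 (hdvd i i.2)).trans ?_
    rw [relOrder_dvd_iff_zsmul]
    rw [← Finset.add_sum_erase _ _ (Finset.mem_univ i)] at hc
    rw [eq_neg_of_add_eq_zero_left hc]
    refine neg_mem (sum_mem fun j hj => zsmul_mem (AddSubgroup.subset_closure ?_) _)
    exact ⟨j.2, fun hji => Finset.ne_of_mem_erase hj (Subtype.ext hji)⟩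
  · rwa [← Nat.card_eq_fintype_card, Nat.card_coe_set_eq]

end RelOrder

section Residues

theorem closure_range_natCast_eq_top {β : Type*} {f : β → ℕ}
    (hf : ∀ p : ℕ, p.Prime → ∃ b, ¬ p ∣ f b) (m : ℕ) :
    AddSubgroup.closure (Set.range fun b => (f b : ZMod m)) = ⊤ := by
  have hone : (1 : ℤ) ∈ AddSubgroup.closure (Set.range fun b => (f b : ℤ)) := by
    obtain ⟨g, hg⟩ := Int.subgroup_cyclic (AddSubgroup.closure (Set.range fun b => (f b : ℤ)))
    by_cases h1 : g.natAbs = 1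
    · rw [hg, AddSubgroup.mem_closure_singleton]
      exact ⟨g, by rw [smul_eq_mul, ← Int.natAbs_mul_self', h1]; norm_num⟩
    · obtain ⟨p, hp, hpg⟩ := Nat.exists_prime_and_dvd h1
      obtain ⟨b, hb⟩ := hf p hp
      have hmem := AddSubgroup.subset_closure
        (Set.mem_range_self (f := fun b => (f b : ℤ)) b)
      rw [hg, SetLike.mem_coe, AddSubgroup.mem_closure_singleton] at hmem
      obtain ⟨c, hc⟩ := hmem
      refine absurd ?_ hb
      rw [← Int.natCast_dvd_natCast, ← hc]
      exact (Int.natCast_dvd.2 hpg).mul_left c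
  have hmem := AddSubgroup.mem_map_of_mem (Int.castAddHom (ZMod m)) hone
  rw [AddMonoidHom.map_closure, ← Set.range_comp] at hmem
  rw [eq_top_iff]
  intro x _
  obtain ⟨k, rfl⟩ := ZMod.intCast_surjective x
  simpa [Function.comp_def] using zsmul_mem hmem k

/-- If the values of `f` have no common prime factor and `f b = m`, then `1` is congruent modulo
`a * m` to a sum of at most `(m - 1) + (a - 1)` values of `f`. -/
theorem exists_multiset_sum_mod_eq_one {β : Type*} {f : β → ℕ}
    (hf : ∀ p : ℕ, p.Prime → ∃ b, ¬ p ∣ f b) {a m : ℕ} (ha : 2 ≤ a) (hm : 2 ≤ m) {b : β}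
    (hb : f b = m) : ∃ T : Multiset β, T.card + 2 ≤ a + m ∧ (T.map f).sum % (a * m) = 1 := by
  have : NeZero m := ⟨by omega⟩
  obtain ⟨l, hl, hls⟩ := exists_short_list_sum _ (closure_range_natCast_eq_top hf m) (1 : ZMod m)
  rw [Nat.card_zmod] at hl
  have hdvd : (m : ℤ) ∣ (l.map f).sum - 1 := by
    rw [← ZMod.intCast_zmod_eq_zero_iff_dvd]
    push_cast
    rw [List.map_map, List.map_map, sub_eq_zero]
    simpa [Function.comp_def] using hls
  obtain ⟨j, hj⟩ := hdvd
  have ha0 : (0 : ℤ) < a := by omega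
  have hx0 := Int.emod_nonneg (-j) ha0.ne'
  have hxa := Int.emod_lt_of_pos (-j) ha0
  have hxj := Int.emod_add_mul_ediv (-j) a
  obtain ⟨x, hx⟩ := Int.eq_ofNat_of_zero_le hx0
  refine ⟨Multiset.replicate x b + (l : Multiset β), ?_, ?_⟩
  · rw [Multiset.card_add, Multiset.card_replicate, Multiset.coe_card]
    omega
  · have hsum : (((Multiset.replicate x b + (l : Multiset β)).map f).sum : ℤ) =
        1 + (a * m : ℕ) * (-(-j / a)) := by
      simp only [Multiset.map_add, Multiset.map_replicate, Multiset.sum_add,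
        Multiset.sum_replicate, Multiset.map_coe, Multiset.sum_coe, hb, smul_eq_mul]
      push_cast at hj ⊢
      rw [hx] at hxj
      linear_combination hj + (m : ℤ) * hxj
    rw [← Int.natCast_inj, Int.natCast_emod, hsum, Int.add_mul_emod_self_left]
    exact Int.emod_eq_of_lt zero_le_one (by exact_mod_cast (by nlinarith : 1 < a * m))

end Residues

section MinimalDistance
variable {G : Type*} [AddCommGroup G] [Finite G]

/-- A product of atoms of cross number one over proper subsets in which the multiplicity of `h` is
congruent to one modulo `addOrderOf h` has a shorter factorization. -/
theorem sInf_deltaSet_add_two_le [DecidableEq G] {G₀ : Set G} {h : G} (hh : h ∈ G₀)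
    (hminimal : ∀ G₁ : Set G, G₁ ⊂ G₀ → DeltaSet G₁ = ∅)
    (hnot : ∀ h' ∈ G₀ \ {h}, h ∉ AddSubgroup.closure (G₀ \ {h, h'}))
    (hcross : ∀ A : Multiset G, IsAtomSeq G₀ A → {x : G | x ∈ A} = G₀ → 1 < crossNum A)
    (ho : 2 ≤ addOrderOf h) {F : Multiset (Multiset G)}
    (hF : ∀ A ∈ F, ∃ h' ∈ G₀ \ {h}, IsAtomSeq (G₀ \ {h'}) A)
    (hmod : F.sum.count h % addOrderOf h = 1) : sInf (DeltaSet G₀) + 2 ≤ F.card := by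
  have hhalf : ∀ g ∈ G₀, ∀ A, IsAtomSeq (G₀ \ {g}) A → crossNum A = 1 := fun g hg A hA =>
    crossNum_eq_one (hminimal _ (Set.sdiff_singleton_ssubset.2 hg)) hA
  have hF₀ : ∀ A ∈ F, IsAtomSeq G₀ A := fun A hA => by
    obtain ⟨h', -, hA⟩ := hF A hA
    exact hA.mono fun g hg => (hA.1.1 g hg).1
  have hF₁ : ∀ A ∈ F, crossNum A = 1 := fun A hA => by
    obtain ⟨h', hh', hA⟩ := hF A hA
    exact hhalf h' hh'.1 A hA
  obtain ⟨t, ht⟩ : ∃ t, F.sum.count h = 1 + t * addOrderOf h :=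
    ⟨F.sum.count h / addOrderOf h, by
      rw [← hmod, mul_comm]; exact (Nat.mod_add_div _ _).symm⟩
  have ht1 : 1 ≤ t := by
    by_contra! ht0
    rw [Nat.lt_one_iff.1 ht0, zero_mul, add_zero] at ht
    obtain ⟨A, hA, hhA⟩ := Multiset.mem_join.1 (Multiset.count_pos.1 (ht ▸ zero_lt_one))
    have hle := Multiset.count_le_of_le h (Multiset.le_sum_of_mem hA)
    obtain ⟨h', hh', hA'⟩ := hF A hA
    have hpos := Multiset.count_pos.2 hhA
    exact count_ne_one_of_isZeroSumSeq_diff (hnot h' hh') hA'.1 (by omega)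
  set U := Multiset.replicate (addOrderOf h) h
  have hU : IsAtomSeq G₀ U := isAtomSeq_replicate_addOrderOf hh
  obtain ⟨S, hS⟩ : ∃ S, F.sum = (Multiset.replicate t U).sum + S := by
    rw [← Multiset.le_iff_exists_add, Multiset.sum_replicate, Multiset.nsmul_replicate,
      ← Multiset.le_count_iff_replicate_le, ht]
    omega
  have hUt : ((Multiset.replicate t U).sum).count h = t * addOrderOf h := by
    rw [Multiset.sum_replicate, Multiset.nsmul_replicate, Multiset.count_replicate_self]
  have hSh : S.count h = 1 := by
    rw [hS, Multiset.count_add, hUt] at ht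
    omega
  have hSz : IsZeroSumSeq G₀ S := by
    have hFz := isZeroSumSeq_sum hF₀
    rw [hS] at hFz
    refine ⟨fun g hg => hFz.1 g (Multiset.mem_add.2 (Or.inr hg)), ?_⟩
    have hUz := (isZeroSumSeq_sum (F := Multiset.replicate t U)
      (fun A hA => Multiset.eq_of_mem_replicate hA ▸ hU)).2
    have := hFz.2
    rwa [Multiset.sum_add, hUz, zero_add] at this
  obtain ⟨E, hE, rfl⟩ := hSz.exists_factorization
  obtain ⟨A, hA, hhA⟩ := Multiset.mem_join.1 (Multiset.count_pos.1 (hSh ▸ zero_lt_one))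
  obtain ⟨R, rfl⟩ := Multiset.exists_cons_of_mem hA
  rw [Multiset.sum_cons, Multiset.count_add] at hSh
  have hpos := Multiset.count_pos.2 hhA
  have hA₀ := hE A (Multiset.mem_cons_self A R)
  have hR : ∀ B ∈ R, crossNum B = 1 := fun B hB => by
    have hB₀ := hE B (Multiset.mem_cons_of_mem hB)
    refine hhalf h hh B (hB₀.mono fun g hg => ⟨hB₀.1.1 g hg, ?_⟩)
    rintro rfl
    have h1 := Multiset.count_le_of_le g (Multiset.le_sum_of_mem hB)
    have h2 := Multiset.count_pos.2 hg
    omega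
  have hAfull : {x : G | x ∈ A} = G₀ := by
    refine Set.Subset.antisymm (fun x hx => hA₀.1.1 x hx) fun x hx => ?_
    by_contra hxA
    have hxh : x ≠ h := by rintro rfl; exact hxA hhA
    exact count_ne_one_of_isZeroSumSeq_diff (hnot x ⟨hx, hxh⟩) (S := A)
      ⟨fun g hg => ⟨hA₀.1.1 g hg, by rintro rfl; exact hxA hg⟩, hA₀.1.2⟩ (by omega)
  have hk := hcross A hA₀ hAfull
  have hcount : (t + 1 + R.card : ℚ) < F.card := by
    rw [← crossNum_sum_eq_card hF₁, hS, Multiset.sum_cons, crossNum_add, crossNum_add,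
      crossNum_sum_eq_card hR, crossNum_sum_eq_card (F := Multiset.replicate t U) fun B hB => by
        rw [Multiset.eq_of_mem_replicate hB, crossNum_replicate_addOrderOf],
      Multiset.card_replicate]
    linarith
  have hlt : t + 1 + R.card < F.card := by exact_mod_cast hcount
  have hcard : (Multiset.replicate t U + A ::ₘ R).card = t + 1 + R.card := by
    rw [Multiset.card_add, Multiset.card_replicate, Multiset.card_cons]; ring
  have hle := sInf_deltaSet_le (G₀ := G₀) (F := Multiset.replicate t U + A ::ₘ R) (F' := F)
    (fun B hB => (Multiset.mem_add.1 hB).elim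
      (fun hB => Multiset.eq_of_mem_replicate hB ▸ hU) (hE B))
    hF₀ (by rw [Multiset.sum_add, hS]) (by omega)
  omega

end MinimalDistance

theorem six_le_of_two_primes_dvd {p q o : ℕ} (hp : p.Prime) (hq : q.Prime) (hpq : p ≠ q)
    (ho : 0 < o) (hpo : p ∣ o) (hqo : q ∣ o) : 6 ≤ o := by
  have hle := Nat.le_of_dvd ho
    (((Nat.coprime_primes hp hq).2 hpq).mul_dvd_of_dvd_of_dvd hpo hqo)
  have := hp.two_le
  have := hq.two_le
  rcases lt_or_gt_of_ne hpq with h | h <;> nlinarith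

theorem stmt_9 {G : Type*} [AddCommGroup G] [Fintype G] (n r : ℕ)
    (hn : AddMonoid.exponent G = n) (hr : grank G = r) (G₀ : Set G)
    (hnhf : DeltaSet G₀ ≠ ∅) (hminimal : ∀ G₁ : Set G, G₁ ⊂ G₀ → DeltaSet G₁ = ∅)
    (hlcn : IsLCNSet G₀) (hcard : r + 2 ≤ G₀.ncard)
    (hgen : ∀ h ∈ G₀, h ∈ AddSubgroup.closure (G₀ \ {h}) ∧
      ∀ h' ∈ G₀ \ {h}, h ∉ AddSubgroup.closure (G₀ \ {h, h'}))
    (hcross : ∀ A : Multiset G, IsAtomSeq G₀ A → {x : G | x ∈ A} = G₀ → 1 < crossNum A) :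
    ((sInf (DeltaSet G₀) : ℕ) : ℚ) ≤ 5 * n / 6 - 4 := by
  classical
  subst hn hr
  obtain ⟨h, hh⟩ : G₀.Nonempty := Set.nonempty_of_ncard_ne_zero (by omega)
  obtain ⟨hmem, hnot⟩ := hgen h hh
  have hprime : ∀ p : ℕ, p.Prime → ∃ h' ∈ G₀ \ {h}, ¬ p ∣ relOrder (G₀ \ {h'}) h := by
    intro p hp
    obtain ⟨h', hh', hdvd⟩ := exists_not_dvd_relOrder (H := G₀ \ {h})
      (by rw [Set.ncard_sdiff_singleton_of_mem hh]; omega) hp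
    exact ⟨h', hh', by rwa [relOrder_comm hmem (hgen h' hh'.1).1]⟩
  have hne : ∀ h' ∈ G₀ \ {h}, relOrder (G₀ \ {h'}) h ≠ 1 := by
    intro h' hh'
    rw [Ne, relOrder_eq_one_iff, Set.sdiff_sdiff, Set.union_comm]
    exact hnot h' hh'
  have hatom : ∀ h' ∈ G₀ \ {h}, ∃ A, IsAtomSeq (G₀ \ {h'}) A ∧
      A.count h = relOrder (G₀ \ {h'}) h := fun h' hh' =>
    exists_isAtomSeq_count_eq_relOrder ⟨hh, fun he => hh'.2 he.symm⟩
  have hopos := addOrderOf_pos h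
  obtain ⟨h₁, hh₁, -⟩ := hprime 2 Nat.prime_two
  have ho1 : addOrderOf h ≠ 1 := fun ho =>
    hne h₁ hh₁ (Nat.dvd_one.1 (ho ▸ relOrder_dvd_addOrderOf _ h))
  obtain ⟨p, hp, hpo⟩ := Nat.exists_prime_and_dvd ho1
  obtain ⟨h₂, hh₂, hpm⟩ := hprime p hp
  have hm := hne h₂ hh₂
  have hmpos := relOrder_pos (G₀ \ {h₂}) h
  have hmo := relOrder_dvd_addOrderOf (G₀ \ {h₂}) h
  obtain ⟨B, hB, hBm⟩ := hatom h₂ hh₂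
  generalize relOrder (G₀ \ {h₂}) h = m at *
  obtain ⟨q, hq, hqm⟩ := Nat.exists_prime_and_dvd hm
  have ho6 := six_le_of_two_primes_dvd hp hq (by rintro rfl; exact hpm hqm) hopos hpo
    (hqm.trans hmo)
  obtain ⟨a, ha⟩ := hmo
  have ha2 : 2 ≤ a := by
    rcases a with _ | _ | a
    · simp [ha] at hopos
    · rw [ha] at hpo; simp [hpm] at hpo
    · omega
  let β := {A : Multiset G // ∃ h' ∈ G₀ \ {h}, IsAtomSeq (G₀ \ {h'}) A}
  obtain ⟨T, hT, hTs⟩ := exists_multiset_sum_mod_eq_one (β := β) (f := fun A => A.1.count h)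
    (fun p hp => by
      obtain ⟨h', hh', hdvd⟩ := hprime p hp
      obtain ⟨A, hA, hAc⟩ := hatom h' hh'
      exact ⟨⟨A, h', hh', hA⟩, by rwa [hAc]⟩) ha2 (by omega : 2 ≤ m)
    (b := ⟨B, h₂, hh₂, hB⟩) hBm
  have hd := sInf_deltaSet_add_two_le hh hminimal hnot hcross (by omega)
    (F := T.map Subtype.val) (fun A hA => by
      obtain ⟨A, -, rfl⟩ := Multiset.mem_map.1 hA
      exact A.2) (by
      rw [← hTs, ha, mul_comm m a]
      congr 1
      rw [← Multiset.coe_countAddMonoidHom, map_multiset_sum, Multiset.map_map]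
      rfl)
  rw [Multiset.card_map] at hd
  have hexp : addOrderOf h ≤ AddMonoid.exponent G :=
    Nat.le_of_dvd (Nat.pos_of_ne_zero AddMonoid.exponent_ne_zero_of_finite)
      (AddMonoid.addOrder_dvd_exponent h)
  have hm2 : 2 ≤ m := by omega
  have hprod : 2 * (a + m) ≤ addOrderOf h + 4 := by
    rw [ha]
    obtain ⟨x, rfl⟩ := Nat.exists_eq_add_of_le ha2
    obtain ⟨y, rfl⟩ := Nat.exists_eq_add_of_le hm2
    nlinarith
  have hfin : 6 * (sInf (DeltaSet G₀)) + 24 ≤ 5 * AddMonoid.exponent G := by omega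
  have hfinq : (6 * (sInf (DeltaSet G₀) : ℕ) + 24 : ℚ) ≤ 5 * (AddMonoid.exponent G : ℕ) := by
    exact_mod_cast hfin
  linarith
end
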